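/- Let V be a positive natural number. For all x, y : Fin V → ℝ, the total variation distance between softmax x and softmax y satisfies D_TV(softmax x, softmax y) = (1/2) · ‖softmax x − softmax y‖₁ ≤ (1/2) · ‖x − y‖₂, where ‖·‖₁ is the ℓ1 norm and ‖·‖₂ is the Euclidean norm. -/

import Mathlib

/-- Softmax of a vector of logits. -/
noncomputable def softmax {V : ℕ} (x : Fin V → ℝ) : Fin V → ℝ :=
  fun i => Real.exp (x i) / ∑ j, Real.exp (x j)

/-- Total variation distance between two vectors, `(1/2) · ∑ i |p i − q i|`. -/
noncomputable def tvDist {V : ℕ} (p q : Fin V → ℝ) : ℝ :=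
  (1 / 2) * ∑ i, |p i - q i|

/-- Euclidean (ℓ2) norm of a vector. -/
noncomputable def l2norm {d : ℕ} (v : Fin d → ℝ) : ℝ :=
  Real.sqrt (∑ k, (v k) ^ 2)

/-- Frobenius (entrywise ℓ2) norm of a matrix. -/
noncomputable def frobNorm {L d : ℕ} (M : Fin L → Fin d → ℝ) : ℝ :=
  Real.sqrt (∑ j, ∑ k, (M j k) ^ 2)

lemma sum_exp_pos {V : ℕ} (hV : 0 < V) (x : Fin V → ℝ) : 0 < ∑ j, Real.exp (x j) :=
  Finset.sum_pos (fun _ _ => Real.exp_pos _) ⟨⟨0, hV⟩, Finset.mem_univ _⟩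

lemma softmax_nonneg {V : ℕ} (x : Fin V → ℝ) (i : Fin V) : 0 ≤ softmax x i := by
  unfold softmax
  positivity

lemma sum_softmax {V : ℕ} (hV : 0 < V) (x : Fin V → ℝ) : ∑ i, softmax x i = 1 := by
  unfold softmax
  rw [← Finset.sum_div, div_self (sum_exp_pos hV x).ne']

lemma hasDerivAt_softmax_line {V : ℕ} (hV : 0 < V) (y h : Fin V → ℝ) (i : Fin V) (t : ℝ) :
    HasDerivAt (fun t : ℝ => softmax (fun j => y j + t * h j) i)
      (softmax (fun j => y j + t * h j) i *
        (h i - ∑ j, softmax (fun j => y j + t * h j) j * h j)) t := by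
  have hexp (j : Fin V) : HasDerivAt (fun t : ℝ => Real.exp (y j + t * h j))
      (Real.exp (y j + t * h j) * h j) t := by
    simpa using (((hasDerivAt_id t).mul_const (h j)).const_add (y j)).exp
  have hsum : HasDerivAt (fun t : ℝ => ∑ j, Real.exp (y j + t * h j))
      (∑ j, Real.exp (y j + t * h j) * h j) t :=
    HasDerivAt.fun_sum fun j _ => hexp j
  have hZ := (sum_exp_pos hV (fun j => y j + t * h j)).ne'
  refine ((hexp i).fun_div hsum hZ).congr_deriv ?_
  simp only [softmax, div_mul_eq_mul_div, ← Finset.sum_div]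
  field_simp

/-- The covariance of `h` with a test vector `s` bounded by one, under probability weights `p`,
is at most the Euclidean norm of `h`. -/
lemma sum_mul_deviation_le_l2norm {V : ℕ} (p s h : Fin V → ℝ) (hp : ∀ i, 0 ≤ p i)
    (hp1 : ∑ i, p i = 1) (hs : ∀ i, s i ^ 2 ≤ 1) :
    ∑ i, s i * (p i * (h i - ∑ j, p j * h j)) ≤ l2norm h := by
  set m := ∑ j, p j * h j with hm
  refine Real.le_sqrt_of_sq_le ?_
  have hcs : (∑ i, s i * (p i * (h i - m))) ^ 2 ≤
      (∑ i, p i * s i ^ 2) * ∑ i, p i * (h i - m) ^ 2 := by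
    refine Finset.sum_sq_le_sum_mul_sum_of_sq_le_mul _ (fun i _ => ?_) (fun i _ => ?_)
      (fun i _ => ?_)
    · exact mul_nonneg (hp i) (sq_nonneg _)
    · exact mul_nonneg (hp i) (sq_nonneg _)
    · exact le_of_eq (by ring)
  have hweight : ∑ i, p i * s i ^ 2 ≤ 1 := by
    rw [← hp1]
    exact Finset.sum_le_sum fun i _ => mul_le_of_le_one_right (hp i) (hs i)
  have hvar : ∑ i, p i * (h i - m) ^ 2 = ∑ i, p i * h i ^ 2 - m ^ 2 := by
    have : ∀ i, p i * (h i - m) ^ 2 = p i * h i ^ 2 - 2 * m * (p i * h i) + m ^ 2 * p i :=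
      fun i => by ring
    simp only [this, Finset.sum_add_distrib, Finset.sum_sub_distrib, ← Finset.mul_sum, hp1, ← hm]
    ring
  have hvar_nonneg : 0 ≤ ∑ i, p i * (h i - m) ^ 2 :=
    Finset.sum_nonneg fun i _ => mul_nonneg (hp i) (sq_nonneg _)
  have hsecond : ∑ i, p i * h i ^ 2 ≤ ∑ i, h i ^ 2 := by
    refine Finset.sum_le_sum fun i _ => mul_le_of_le_one_left (sq_nonneg _) ?_
    rw [← hp1]
    exact Finset.single_le_sum (fun j _ => hp j) (Finset.mem_univ i)
  nlinarith [mul_le_of_le_one_left hvar_nonneg hweight, sq_nonneg m]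

lemma sum_abs_softmax_sub_le_l2norm {V : ℕ} (hV : 0 < V) (x y : Fin V → ℝ) :
    ∑ i, |softmax x i - softmax y i| ≤ l2norm (fun i => x i - y i) := by
  set h : Fin V → ℝ := fun i => x i - y i with hh
  set s : Fin V → ℝ := fun i => if 0 ≤ softmax x i - softmax y i then 1 else -1 with hs
  have hs_sq (i : Fin V) : s i ^ 2 ≤ 1 := by
    simp only [hs]
    split_ifs <;> norm_num
  have habs (i : Fin V) : |softmax x i - softmax y i| = s i * (softmax x i - softmax y i) := by
    simp only [hs]
    split_ifs with hi
    · rw [abs_of_nonneg hi, one_mul]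
    · rw [abs_of_neg (not_le.mp hi), neg_one_mul]
  let φ : ℝ → ℝ := fun t => ∑ i, s i * softmax (fun j => y j + t * h j) i
  have hφ (t : ℝ) : HasDerivAt φ (∑ i, s i * (softmax (fun j => y j + t * h j) i *
      (h i - ∑ j, softmax (fun j => y j + t * h j) j * h j))) t :=
    HasDerivAt.fun_sum fun i _ => (hasDerivAt_softmax_line hV y h i t).const_mul (s i)
  obtain ⟨c, -, hc⟩ := exists_hasDerivAt_eq_slope φ _ zero_lt_one
    (fun t _ => (hφ t).continuousAt.continuousWithinAt) (fun t _ => hφ t)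
  have hbound := sum_mul_deviation_le_l2norm (softmax fun j => y j + c * h j) s h
    (softmax_nonneg _) (sum_softmax hV _) hs_sq
  rw [hc] at hbound
  simpa [φ, hh, habs, mul_sub, Finset.sum_sub_distrib] using hbound

/-- The ℓ2-to-total-variation Lipschitz bound for softmax:
`D_TV(softmax x, softmax y) = (1/2)·‖softmax x − softmax y‖₁ ≤ (1/2)·‖x − y‖₂`. -/
theorem softmax_tv_l2_bound {V : ℕ} (hV : 0 < V) (x y : Fin V → ℝ) :
    tvDist (softmax x) (softmax y) =
        (1 / 2) * ∑ i, |softmax x i - softmax y i| ∧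
      tvDist (softmax x) (softmax y) ≤ (1 / 2) * l2norm (fun i => x i - y i) := by
  exact ⟨rfl, mul_le_mul_of_nonneg_left (sum_abs_softmax_sub_le_l2norm hV x y) (by norm_num)⟩
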